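/- Let (f_0,…,f_5) be a rational solution of A_5(α_0,…,α_5) such that for some i ∈ {0,…,5}, f_i, f_{i+1}, f_{i+2}, f_{i+4} have a pole at t=∞ and f_{i+3}, f_{i+5} are holomorphic at t=∞. Then, as |t| → ∞: t·(f_i(t) − t) → −α_{i+2} − 2α_{i+3} − α_{i+4}, t·(f_{i+1}(t) − t) → −α_{i+3} + α_{i+5}, t·(f_{i+2}(t) − t) → α_i + α_{i+4} + 2α_{i+5}, t·f_{i+3}(t) → α_{i+3}, t·(f_{i+4}(t) + t) → −α_i + α_{i+2} + 2α_{i+3} − 2α_{i+5}, and t·f_{i+5}(t) → −α_{i+5}. In particular f_i, f_{i+1}, f_{i+2}, f_{i+4} have a pole of order one at t=∞, with leading coefficients 1, 1, 1, −1 respectively. -/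

import Mathlib

open Filter Topology Polynomial

noncomputable section

/-- Evaluation of a complex rational function at a point (junk value where the
reduced denominator vanishes). -/
def evalR (f : RatFunc ℂ) (t : ℂ) : ℂ := RatFunc.eval (RingHom.id ℂ) t f

/-- `f` is defined at `t`: the reduced denominator does not vanish at `t`. -/
def DefinedAt (f : RatFunc ℂ) (t : ℂ) : Prop := Polynomial.eval t (RatFunc.denom f) ≠ 0

/-- `(f 0, …, f 5)` is a rational solution of the `A₅⁽¹⁾` Painlevé system `A₅(α)`:
the two constraints hold identically as rational functions, and the six ODEs hold at
every point where all six components are defined.  (Indices are taken in `Fin 6`,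
i.e. modulo `6`.) -/
def IsA5Solution (α : Fin 6 → ℂ) (f : Fin 6 → RatFunc ℂ) : Prop :=
  f 0 + f 2 + f 4 = RatFunc.X ∧
  f 1 + f 3 + f 5 = RatFunc.X ∧
  ∀ t : ℂ, (∀ j : Fin 6, DefinedAt (f j) t) → ∀ i : Fin 6,
    t / 2 * deriv (evalR (f i)) t =
      evalR (f i) t *
        (evalR (f (i + 1)) t * evalR (f (i + 2)) t
          + evalR (f (i + 1)) t * evalR (f (i + 4)) t
          + evalR (f (i + 3)) t * evalR (f (i + 4)) t
          - evalR (f (i + 2)) t * evalR (f (i + 3)) t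
          - evalR (f (i + 2)) t * evalR (f (i + 5)) t
          - evalR (f (i + 4)) t * evalR (f (i + 5)) t)
      + (1 / 2 - α (i + 2) - α (i + 4)) * evalR (f i) t
      + α i * (evalR (f (i + 2)) t + evalR (f (i + 4)) t)

/-- `f` has a pole at `t = ∞`: `‖f t‖ → ∞` as `‖t‖ → ∞`. -/
def PoleAtInfty (f : RatFunc ℂ) : Prop :=
  Tendsto (fun t => ‖evalR f t‖) (Bornology.cobounded ℂ) atTop

/-- `f` is holomorphic at `t = ∞`: `f` is bounded as `‖t‖ → ∞`. -/
def HoloAtInfty (f : RatFunc ℂ) : Prop :=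
  IsBoundedUnder (· ≤ ·) (Bornology.cobounded ℂ) fun t => ‖evalR f t‖

/-- `f` has a pole at `c ∈ ℂ`: `‖f t‖ → ∞` as `t → c`. -/
def PoleAt (f : RatFunc ℂ) (c : ℂ) : Prop :=
  Tendsto (fun t => ‖evalR f t‖) (𝓝[≠] c) atTop

/-- `f` is regular at `c ∈ ℂ`: it extends continuously to `c`. -/
def RegularAt (f : RatFunc ℂ) (c : ℂ) : Prop :=
  ∃ L : ℂ, Tendsto (fun t => evalR f t) (𝓝[≠] c) (𝓝 L)

/-- `z` is an integer. -/
def IsInt (z : ℂ) : Prop := ∃ n : ℤ, z = (n : ℂ)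

/-- `z` is an even integer. -/
def IsEvenInt (z : ℂ) : Prop := ∃ n : ℤ, z = 2 * (n : ℂ)

/-- A tuple of rational functions has pole configuration of Type A at `t = ∞`. -/
def TypeA (f : Fin 6 → RatFunc ℂ) : Prop :=
  ∃ i : Fin 6,
    (PoleAtInfty (f i) ∧ PoleAtInfty (f (i + 1)) ∧ HoloAtInfty (f (i + 2)) ∧
      HoloAtInfty (f (i + 3)) ∧ HoloAtInfty (f (i + 4)) ∧ HoloAtInfty (f (i + 5))) ∨
    (PoleAtInfty (f i) ∧ PoleAtInfty (f (i + 3)) ∧ HoloAtInfty (f (i + 1)) ∧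
      HoloAtInfty (f (i + 2)) ∧ HoloAtInfty (f (i + 4)) ∧ HoloAtInfty (f (i + 5))) ∨
    (PoleAtInfty (f i) ∧ PoleAtInfty (f (i + 1)) ∧ PoleAtInfty (f (i + 2)) ∧
      PoleAtInfty (f (i + 4)) ∧ HoloAtInfty (f (i + 3)) ∧ HoloAtInfty (f (i + 5)))

/-- A tuple of rational functions has pole configuration of Type B at `t = ∞`. -/
def TypeB (f : Fin 6 → RatFunc ℂ) : Prop :=
  ∃ i : Fin 6,
    PoleAtInfty (f i) ∧ PoleAtInfty (f (i + 1)) ∧ PoleAtInfty (f (i + 2)) ∧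
    PoleAtInfty (f (i + 3)) ∧ HoloAtInfty (f (i + 4)) ∧ HoloAtInfty (f (i + 5))


open Bornology Asymptotics

theorem tendsto_eval_div_pow (p : ℂ[X]) (N : ℕ) (hN : p.natDegree ≤ N) :
    Tendsto (fun t => p.eval t / t ^ N) (cobounded ℂ) (𝓝 (p.coeff N)) := by
  have h : Tendsto (fun t : ℂ => (p.reflect N).eval t⁻¹) (cobounded ℂ) (𝓝 ((p.reflect N).eval 0)) :=
    ((p.reflect N).continuous.tendsto 0).comp tendsto_inv₀_cobounded
  have h0 : (p.reflect N).eval 0 = p.coeff N := by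
    rw [← coeff_zero_eq_eval_zero, coeff_reflect, revAt_le (Nat.zero_le _), Nat.sub_zero]
  rw [h0] at h
  refine h.congr' ?_
  filter_upwards [eventually_ne_cobounded (0 : ℂ)] with t ht
  let := invertibleOfNonzero ht
  have := eval₂_reflect_mul_pow (RingHom.id ℂ) t N p hN
  rw [eq_div_iff (pow_ne_zero _ ht)]
  simpa [eval₂_id] using this

theorem eventually_eval_ne_zero {p : ℂ[X]} (hp : p ≠ 0) :
    ∀ᶠ t in cobounded ℂ, p.eval t ≠ 0 := by
  have h := (tendsto_eval_div_pow p p.natDegree le_rfl).eventually_ne (b₂ := 0)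
    (leadingCoeff_ne_zero.2 hp)
  filter_upwards [h] with t ht h0
  simp [h0] at ht

theorem tendsto_mul_derivative_div (p : ℂ[X]) (hp : p ≠ 0) :
    Tendsto (fun t => t * p.derivative.eval t / p.eval t) (cobounded ℂ) (𝓝 p.natDegree) := by
  have h1 := tendsto_eval_div_pow p p.natDegree le_rfl
  have hdeg : (X * derivative p).natDegree ≤ p.natDegree := by
    by_cases h : p.natDegree = 0
    · rw [natDegree_eq_zero] at h
      obtain ⟨c, rfl⟩ := h
      simp
    · have := natDegree_derivative_le p
      have := natDegree_mul_le (p := X) (q := derivative p)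
      rw [natDegree_X] at this
      omega
  have h2 := tendsto_eval_div_pow _ _ hdeg
  have hc : (X * derivative p).coeff p.natDegree = p.natDegree * p.leadingCoeff := by
    cases h : p.natDegree with
    | zero => simp
    | succ n =>
      rw [coeff_X_mul, coeff_derivative, leadingCoeff, h]
      push_cast
      ring
  have h3 := h2.div h1 (leadingCoeff_ne_zero.2 hp)
  rw [hc, coeff_natDegree, mul_div_cancel_right₀ _ (leadingCoeff_ne_zero.2 hp)] at h3
  refine h3.congr' ?_
  filter_upwards [eventually_ne_cobounded (0 : ℂ)] with t ht
  rw [Pi.div_apply, div_div_div_cancel_right₀ (pow_ne_zero _ ht)]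
  simp
theorem isBigO_zpow_cobounded {j k : ℤ} (h : j ≤ k) :
    (fun t : ℂ => t ^ j) =O[cobounded ℂ] fun t => t ^ k := by
  refine IsBigO.of_bound 1 ?_
  filter_upwards [tendsto_norm_cobounded_atTop.eventually_ge_atTop 1] with t ht
  rw [norm_zpow, norm_zpow, one_mul]
  exact zpow_le_zpow_right₀ ht h

theorem isBigO_one_id_cobounded : (fun _ => 1 : ℂ → ℂ) =O[cobounded ℂ] fun t => t := by
  simpa using isBigO_zpow_cobounded zero_le_one

theorem not_isBigO_one_of_tendsto_norm {u : ℂ → ℂ}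
    (hu : Tendsto (fun t => ‖u t‖) (cobounded ℂ) atTop) :
    ¬ u =O[cobounded ℂ] (fun _ => 1 : ℂ → ℂ) := by
  intro h
  exact not_isBoundedUnder_of_tendsto_atTop hu ((isBigO_one_iff ℂ).1 h)

theorem le_of_isBigO_zpow_cobounded {j k : ℤ}
    (h : (fun t : ℂ => t ^ j) =O[cobounded ℂ] fun t => t ^ k) : j ≤ k := by
  by_contra! hlt
  have h1 : (fun t : ℂ => t ^ (k + 1)) =O[cobounded ℂ] fun t => t ^ k :=
    (isBigO_zpow_cobounded hlt).trans h
  have h2 := h1.mul (isBigO_refl (fun t : ℂ => t ^ (-k)) (cobounded ℂ))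
  refine not_isBigO_one_of_tendsto_norm (u := id) tendsto_norm_cobounded_atTop
    (h2.congr' ?_ ?_) <;>
  · filter_upwards [eventually_ne_cobounded (0 : ℂ)] with t ht
    rw [← zpow_add₀ ht]
    simp

theorem evalR_eq_div (f : RatFunc ℂ) (t : ℂ) : evalR f t = f.num.eval t / f.denom.eval t := by
  simp [evalR, RatFunc.eval, eval₂_id]

theorem eventually_definedAt (f : RatFunc ℂ) : ∀ᶠ t in cobounded ℂ, DefinedAt f t :=
  eventually_eval_ne_zero f.denom_ne_zero

theorem eventually_evalR_ne_zero {f : RatFunc ℂ} (hf : f ≠ 0) :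
    ∀ᶠ t in cobounded ℂ, evalR f t ≠ 0 := by
  filter_upwards [eventually_definedAt f, eventually_eval_ne_zero (RatFunc.num_ne_zero hf)]
    with t h1 h2
  rw [evalR_eq_div]
  exact div_ne_zero h2 h1

theorem isTheta_zpow_evalR {f : RatFunc ℂ} (hf : f ≠ 0) :
    evalR f =Θ[cobounded ℂ] fun t => t ^ (f.num.natDegree - f.denom.natDegree : ℤ) := by
  have h (p : ℂ[X]) (hp : p ≠ 0) : (fun t => p.eval t) =Θ[cobounded ℂ] fun t => t ^ p.natDegree := by
    have h1 := tendsto_eval_div_pow p _ le_rfl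
    exact (isTheta_of_div_tendsto_nhds_ne_zero h1 (leadingCoeff_ne_zero.2 hp)).symm
  have hdiv := (h _ (RatFunc.num_ne_zero hf)).div (h _ f.denom_ne_zero)
  rw [show evalR f = fun t => f.num.eval t / f.denom.eval t from funext (evalR_eq_div f)]
  refine hdiv.trans_eventuallyEq ?_
  filter_upwards [eventually_ne_cobounded (0 : ℂ)] with t ht
  rw [zpow_sub₀ ht]
  simp

theorem tendsto_logDeriv_evalR {f : RatFunc ℂ} (hf : f ≠ 0) :
    Tendsto (fun t => t * deriv (evalR f) t / evalR f t) (cobounded ℂ)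
      (𝓝 ((f.num.natDegree - f.denom.natDegree : ℤ) : ℂ)) := by
  have h := (tendsto_mul_derivative_div _ (RatFunc.num_ne_zero hf)).sub
    (tendsto_mul_derivative_div _ f.denom_ne_zero)
  push_cast
  refine h.congr' ?_
  filter_upwards [eventually_definedAt f, eventually_eval_ne_zero (RatFunc.num_ne_zero hf)]
    with t h1 h2
  have h1 : f.denom.eval t ≠ 0 := h1
  have hd : deriv (evalR f) t = (f.num.derivative.eval t * f.denom.eval t -
      f.num.eval t * f.denom.derivative.eval t) / f.denom.eval t ^ 2 := by
    rw [show evalR f = fun t => f.num.eval t / f.denom.eval t from funext (evalR_eq_div f)]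
    exact ((f.num.hasDerivAt t).div (f.denom.hasDerivAt t) h1).deriv
  rw [hd, evalR_eq_div]
  field_simp

theorem PoleAtInfty.ne_zero {f : RatFunc ℂ} (hf : PoleAtInfty f) : f ≠ 0 := by
  rintro rfl
  refine not_isBigO_one_of_tendsto_norm hf ?_
  have : evalR 0 = fun _ => 0 := by
    funext t
    simp [evalR]
  rw [this]
  exact isBigO_zero _ _

theorem PoleAtInfty.isBigO_id {f : RatFunc ℂ} (hf : PoleAtInfty f) :
    (fun t => t) =O[cobounded ℂ] evalR f := by
  have h := isTheta_zpow_evalR hf.ne_zero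
  have hk : (1 : ℤ) ≤ f.num.natDegree - f.denom.natDegree := by
    by_contra! hlt
    have h2 := h.1.trans (isBigO_zpow_cobounded (Int.lt_add_one_iff.1 hlt : _ ≤ (0 : ℤ)))
    exact not_isBigO_one_of_tendsto_norm hf (by simpa using h2)
  simpa using (isBigO_zpow_cobounded hk).trans h.2

theorem PoleAtInfty.exists_isBigO_pow {f : RatFunc ℂ} (hf : PoleAtInfty f) :
    ∃ N : ℕ, ∀ M ≥ N, evalR f =O[cobounded ℂ] fun t => t ^ M := by
  refine ⟨f.num.natDegree, fun M hM => ?_⟩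
  have h := (isTheta_zpow_evalR hf.ne_zero).1.trans
    (isBigO_zpow_cobounded (k := (M : ℤ)) (by omega))
  simpa using h

theorem HoloAtInfty.isBigO_one {f : RatFunc ℂ} (hf : HoloAtInfty f) :
    evalR f =O[cobounded ℂ] (fun _ => 1 : ℂ → ℂ) :=
  (isBigO_one_iff ℂ).2 hf

theorem tendsto_logDeriv_evalR_of_isTheta_id {f : RatFunc ℂ}
    (hf : evalR f =Θ[cobounded ℂ] fun t => t) (h0 : f ≠ 0) :
    Tendsto (fun t => t * deriv (evalR f) t / evalR f t) (cobounded ℂ) (𝓝 1) := by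
  have h := (isTheta_zpow_evalR h0).symm.trans hf
  have hk : (f.num.natDegree - f.denom.natDegree : ℤ) = 1 :=
    le_antisymm (le_of_isBigO_zpow_cobounded (by simpa using h.1))
      (le_of_isBigO_zpow_cobounded (by simpa using h.2))
  simpa [hk] using tendsto_logDeriv_evalR h0

theorem exists_logDeriv_isBigO_one (f : RatFunc ℂ) :
    ∃ κ : ℂ → ℂ, κ =O[cobounded ℂ] (fun _ => 1 : ℂ → ℂ) ∧
      ∀ᶠ t in cobounded ℂ, t * deriv (evalR f) t = κ t * evalR f t := by
  by_cases hf : f = 0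
  · refine ⟨0, isBigO_zero _ _, .of_forall fun t => ?_⟩
    have : evalR f = fun _ => 0 := by
      funext t
      simp [evalR, hf]
    simp [this]
  · refine ⟨_, (tendsto_logDeriv_evalR hf).isBigO_one ℂ, ?_⟩
    filter_upwards [eventually_evalR_ne_zero hf] with t ht
    rw [div_mul_cancel₀ _ ht]

theorem eventually_evalR_sum_eq {f g h : RatFunc ℂ} (hs : f + g + h = RatFunc.X) :
    ∀ᶠ t in cobounded ℂ, evalR f t + evalR g t + evalR h t = t := by
  filter_upwards [eventually_definedAt f, eventually_definedAt g, eventually_definedAt h,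
    eventually_definedAt (f + g)] with t hf hg hh hfg
  simp only [DefinedAt, ← eval₂_id] at hf hg hh hfg
  have hsum : evalR (f + g + h) t = t := by simp [hs, evalR]
  have h1 : evalR (f + g) t = evalR f t + evalR g t := RatFunc.eval_add _ _ hf hg
  have h2 : evalR (f + g + h) t = evalR (f + g) t + evalR h t := RatFunc.eval_add _ _ hfg hh
  rw [← h1, ← h2, hsum]

theorem isBigO_of_id_mul {u : ℂ → ℂ} {N : ℕ}
    (h : (fun t => t * u t) =O[cobounded ℂ] fun t => t ^ (N + 1)) :
    u =O[cobounded ℂ] fun t => t ^ N := by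
  refine ((isBigO_refl (fun t : ℂ => t⁻¹) (cobounded ℂ)).mul h).congr' ?_ ?_ <;>
  filter_upwards [eventually_ne_cobounded (0 : ℂ)] with t ht
  · field_simp
  · field_simp
    ring

theorem isBigO_one_of_isBigO_pow {u v d g r s : ℂ → ℂ}
    (hd : d =O[cobounded ℂ] (fun _ => 1 : ℂ → ℂ)) (hg : g =O[cobounded ℂ] (fun _ => 1 : ℂ → ℂ))
    (hr : r =O[cobounded ℂ] (fun _ => 1 : ℂ → ℂ)) (hs : s =O[cobounded ℂ] (fun _ => 1 : ℂ → ℂ))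
    (hu : ∀ᶠ t in cobounded ℂ, t * u t = r t + d t * (2 * t - 2 * v t) + g t * (2 * u t))
    (hv : ∀ᶠ t in cobounded ℂ, t * v t = s t + g t * (2 * t - 2 * u t) + d t * (2 * v t))
    (N : ℕ) (huN : u =O[cobounded ℂ] fun t => t ^ N) (hvN : v =O[cobounded ℂ] fun t => t ^ N) :
    u =O[cobounded ℂ] (fun _ => 1 : ℂ → ℂ) ∧ v =O[cobounded ℂ] (fun _ => 1 : ℂ → ℂ) := by
  induction N with
  | zero => simpa using And.intro huN hvN
  | succ N ih =>
    have hpow : (fun t : ℂ => t) =O[cobounded ℂ] fun t => t ^ (N + 1) := by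
      simpa [pow_succ] using isBigO_one_id_cobounded.pow N |>.mul (isBigO_refl (fun t : ℂ => t) _)
    have h1 := isBigO_one_id_cobounded.trans hpow
    have key {x y : ℂ → ℂ} (hx : x =O[cobounded ℂ] (fun _ => 1 : ℂ → ℂ))
        (hy : y =O[cobounded ℂ] fun t => t ^ (N + 1)) :
        (fun t => x t * y t) =O[cobounded ℂ] fun t => t ^ (N + 1) := by
      simpa using hx.mul hy
    apply ih
    · refine isBigO_of_id_mul (IsBigO.congr' ?_ (hu.mono fun t ht => ht.symm) .rfl)
      exact ((hr.trans h1).add (key hd ((hpow.const_mul_left 2).sub (hvN.const_mul_left 2)))).add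
        (key hg (huN.const_mul_left 2))
    · refine isBigO_of_id_mul (IsBigO.congr' ?_ (hv.mono fun t ht => ht.symm) .rfl)
      exact ((hs.trans h1).add (key hg ((hpow.const_mul_left 2).sub (huN.const_mul_left 2)))).add
        (key hd (hvN.const_mul_left 2))

theorem tendsto_div_id_of_isBigO_one {x : ℂ → ℂ}
    (hx : x =O[cobounded ℂ] (fun _ => 1 : ℂ → ℂ)) :
    Tendsto (fun t => x t / t) (cobounded ℂ) (𝓝 0) := by
  simpa [div_eq_mul_inv, mul_comm] using
    tendsto_inv₀_cobounded.zero_mul_isBoundedUnder_le ((isBigO_one_iff ℂ).1 hx)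

theorem tendsto_id_mul_of_mul_eq {x F q : ℂ → ℂ} {l m : ℂ} (hl : l ≠ 0)
    (hF : Tendsto (fun t => F t / t ^ 2) (cobounded ℂ) (𝓝 l))
    (hq : Tendsto (fun t => q t / t) (cobounded ℂ) (𝓝 m))
    (h : ∀ᶠ t in cobounded ℂ, x t * F t = q t) :
    Tendsto (fun t => t * x t) (cobounded ℂ) (𝓝 (m / l)) := by
  refine (hq.div hF hl).congr' ?_
  filter_upwards [h, hF.eventually_ne hl, eventually_ne_cobounded (0 : ℂ)] with t ht hFt h0
  have : F t ≠ 0 := fun h => by simp [h] at hFt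
  rw [Pi.div_apply, ← ht]
  field_simp

theorem tendsto_quadratic_div_sq {d g w z s : ℂ → ℂ} {l m : ℂ}
    (hd : d =O[cobounded ℂ] (fun _ => 1 : ℂ → ℂ)) (hg : g =O[cobounded ℂ] (fun _ => 1 : ℂ → ℂ))
    (hw : w =O[cobounded ℂ] (fun _ => 1 : ℂ → ℂ)) (hz : z =O[cobounded ℂ] (fun _ => 1 : ℂ → ℂ))
    (hs : s =O[cobounded ℂ] (fun _ => 1 : ℂ → ℂ)) :
    Tendsto (fun t => ((t - d t - g t) * (l * t + w t) + d t * (m * t + z t) + s t) / t ^ 2)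
      (cobounded ℂ) (𝓝 l) := by
  have hd := tendsto_div_id_of_isBigO_one hd
  have hg := tendsto_div_id_of_isBigO_one hg
  have hw := tendsto_div_id_of_isBigO_one hw
  have hz := tendsto_div_id_of_isBigO_one hz
  have hs := tendsto_div_id_of_isBigO_one hs
  have h := ((((tendsto_const_nhds (x := (1 : ℂ))).sub hd).sub hg).mul (hw.const_add l)).add
    (hd.mul (hz.const_add m)) |>.add (hs.mul tendsto_inv₀_cobounded)
  have h' := h.congr' (f₂ := fun t =>
    ((t - d t - g t) * (l * t + w t) + d t * (m * t + z t) + s t) / t ^ 2) (by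
      filter_upwards [eventually_ne_cobounded (0 : ℂ)] with t ht
      field_simp)
  simpa using h'

theorem tendsto_id_mul_of_eq {u v d g r : ℂ → ℂ} {ρ δ γ : ℂ}
    (huO : u =O[cobounded ℂ] (fun _ => 1 : ℂ → ℂ)) (hvO : v =O[cobounded ℂ] (fun _ => 1 : ℂ → ℂ))
    (hd : Tendsto (fun t => t * d t) (cobounded ℂ) (𝓝 δ))
    (hg : Tendsto (fun t => t * g t) (cobounded ℂ) (𝓝 γ))
    (hr : Tendsto r (cobounded ℂ) (𝓝 ρ))
    (hu : ∀ᶠ t in cobounded ℂ, t * u t = r t + d t * (2 * t - 2 * v t) + g t * (2 * u t)) :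
    Tendsto (fun t => t * u t) (cobounded ℂ) (𝓝 (ρ + 2 * δ)) := by
  have hu0 := tendsto_div_id_of_isBigO_one huO
  have hv0 := tendsto_div_id_of_isBigO_one hvO
  have h := (hr.add (hd.mul ((hv0.const_mul 2).const_sub 2))).add (hg.mul (hu0.const_mul 2))
  have h' := h.congr' (f₂ := fun t => t * u t) (by
    filter_upwards [hu, eventually_ne_cobounded (0 : ℂ)] with t ht h0
    rw [ht]
    field_simp)
  simpa [mul_comm] using h'

/-- Laurent behaviour at `t = ∞` for a Type A (3) rational solution. -/
theorem stmt_9 (α : Fin 6 → ℂ) (f : Fin 6 → RatFunc ℂ) (i : Fin 6)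
    (hsum : α 0 + α 1 + α 2 + α 3 + α 4 + α 5 = 1)
    (hsol : IsA5Solution α f)
    (hpi : PoleAtInfty (f i)) (hpi1 : PoleAtInfty (f (i + 1)))
    (hpi2 : PoleAtInfty (f (i + 2))) (hpi4 : PoleAtInfty (f (i + 4)))
    (hh3 : HoloAtInfty (f (i + 3))) (hh5 : HoloAtInfty (f (i + 5))) :
    Tendsto (fun t => t * (evalR (f i) t - t)) (Bornology.cobounded ℂ)
        (𝓝 (-α (i + 2) - 2 * α (i + 3) - α (i + 4))) ∧
    Tendsto (fun t => t * (evalR (f (i + 1)) t - t)) (Bornology.cobounded ℂ)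
        (𝓝 (-α (i + 3) + α (i + 5))) ∧
    Tendsto (fun t => t * (evalR (f (i + 2)) t - t)) (Bornology.cobounded ℂ)
        (𝓝 (α i + α (i + 4) + 2 * α (i + 5))) ∧
    Tendsto (fun t => t * evalR (f (i + 3)) t) (Bornology.cobounded ℂ) (𝓝 (α (i + 3))) ∧
    Tendsto (fun t => t * (evalR (f (i + 4)) t + t)) (Bornology.cobounded ℂ)
        (𝓝 (-α i + α (i + 2) + 2 * α (i + 3) - 2 * α (i + 5))) ∧
    Tendsto (fun t => t * evalR (f (i + 5)) t) (Bornology.cobounded ℂ) (𝓝 (-α (i + 5))) := by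
  have hconstr (j : Fin 6) : f j + f (j + 2) + f (j + 4) = RatFunc.X := by
    obtain ⟨h0, h1, -⟩ := hsol
    fin_cases j <;> simp <;> first | linear_combination h0 | linear_combination h1
  have hace := eventually_evalR_sum_eq (hconstr i)
  have hbdg := eventually_evalR_sum_eq (hconstr (i + 1))
  have hdef : ∀ᶠ t in cobounded ℂ, ∀ j, DefinedAt (f j) t :=
    eventually_all.2 fun j => eventually_definedAt (f j)
  have hode := hdef.mono fun t ht => hsol.2.2 t ht
  have e12 : i + 1 + 2 = i + 3 := by rw [add_assoc]; rfl
  have e14 : i + 1 + 4 = i + 5 := by rw [add_assoc]; rfl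
  have e21 : i + 2 + 1 = i + 3 := by rw [add_assoc]; rfl
  have e22 : i + 2 + 2 = i + 4 := by rw [add_assoc]; rfl
  have e23 : i + 2 + 3 = i + 5 := by rw [add_assoc]; rfl
  have e24 : i + 2 + 4 = i := by rw [add_assoc]; exact add_zero i
  have e25 : i + 2 + 5 = i + 1 := by rw [add_assoc]; rfl
  have e31 : i + 3 + 1 = i + 4 := by rw [add_assoc]; rfl
  have e32 : i + 3 + 2 = i + 5 := by rw [add_assoc]; rfl
  have e33 : i + 3 + 3 = i := by rw [add_assoc]; exact add_zero i
  have e34 : i + 3 + 4 = i + 1 := by rw [add_assoc]; rfl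
  have e35 : i + 3 + 5 = i + 2 := by rw [add_assoc]; rfl
  have e51 : i + 5 + 1 = i := by rw [add_assoc]; exact add_zero i
  have e52 : i + 5 + 2 = i + 1 := by rw [add_assoc]; rfl
  have e53 : i + 5 + 3 = i + 2 := by rw [add_assoc]; rfl
  have e54 : i + 5 + 4 = i + 3 := by rw [add_assoc]; rfl
  have e55 : i + 5 + 5 = i + 4 := by rw [add_assoc]; rfl
  have hodea := hode.mono fun t ht => ht i
  have hodec := hode.mono fun t ht => ht (i + 2)
  have hoded := hode.mono fun t ht => ht (i + 3)
  have hodeg := hode.mono fun t ht => ht (i + 5)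
  simp only [e12, e14, e21, e22, e23, e24, e25, e31, e32, e33, e34, e35, e51, e52, e53, e54, e55]
    at hbdg hodec hoded hodeg
  have hdO := hh3.isBigO_one
  have hgO := hh5.isBigO_one
  have hida := hpi.isBigO_id
  have hidc := hpi2.isBigO_id
  have ha0 := eventually_evalR_ne_zero hpi.ne_zero
  have hc0 := eventually_evalR_ne_zero hpi2.ne_zero
  obtain ⟨Na, hNa⟩ := hpi.exists_isBigO_pow
  obtain ⟨Nc, hNc⟩ := hpi2.exists_isBigO_pow
  obtain ⟨κd, hκd, hκd'⟩ := exists_logDeriv_isBigO_one (f (i + 3))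
  obtain ⟨κg, hκg, hκg'⟩ := exists_logDeriv_isBigO_one (f (i + 5))
  have hκa := (tendsto_logDeriv_evalR hpi.ne_zero).isBigO_one ℂ
  have hκc := (tendsto_logDeriv_evalR hpi2.ne_zero).isBigO_one ℂ
  have hκa1 := fun h => tendsto_logDeriv_evalR_of_isTheta_id h hpi.ne_zero
  have hκc1 := fun h => tendsto_logDeriv_evalR_of_isTheta_id h hpi2.ne_zero
  clear hsol hconstr hdef hode hpi hpi1 hpi2 hpi4 hh3 hh5 hsum e12 e14 e21 e22 e23 e24 e25 e31 e32
    e33 e34 e35 e51 e52 e53 e54 e55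
  generalize evalR (f i) = a at *
  generalize evalR (f (i + 1)) = b at *
  generalize evalR (f (i + 2)) = c at *
  generalize evalR (f (i + 3)) = d at *
  generalize evalR (f (i + 4)) = e at *
  generalize evalR (f (i + 5)) = g at *
  generalize α i = A0 at *
  generalize α (i + 1) = A1 at *
  generalize α (i + 2) = A2 at *
  generalize α (i + 3) = A3 at *
  generalize α (i + 4) = A4 at *
  generalize α (i + 5) = A5 at *
  set u : ℂ → ℂ := fun t => t - a t with hu
  set v : ℂ → ℂ := fun t => t - c t with hv
  set κa : ℂ → ℂ := fun t => t * deriv a t / a t with hκa_def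
  set κc : ℂ → ℂ := fun t => t * deriv c t / c t with hκc_def
  set r : ℂ → ℂ := fun t => κa t / 2 - (1 / 2 - A2 - A4) - A0 * (u t / a t) with hr
  set s : ℂ → ℂ := fun t => -(κc t / 2) + (1 / 2 - A4 - A0) + A2 * (v t / c t) with hs
  have hconst (z : ℂ) : (fun _ => z : ℂ → ℂ) =O[cobounded ℂ] (fun _ => 1 : ℂ → ℂ) :=
    isBigO_const_const z one_ne_zero _
  have hdefect {x : ℂ → ℂ} (hx : (fun t => t) =O[cobounded ℂ] x)
      (hx0 : ∀ᶠ t in cobounded ℂ, x t ≠ 0) :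
      (fun t => (t - x t) / x t) =O[cobounded ℂ] (fun _ => 1 : ℂ → ℂ) := by
    have h := (hx.sub (isBigO_refl x _)).mul (isBigO_refl (fun t => (x t)⁻¹) (cobounded ℂ))
    refine h.congr' .rfl ?_
    filter_upwards [hx0] with t ht using mul_inv_cancel₀ ht
  have hhalf {x : ℂ → ℂ} (hx : x =O[cobounded ℂ] (fun _ => 1 : ℂ → ℂ)) :
      (fun t => x t / 2) =O[cobounded ℂ] (fun _ => 1 : ℂ → ℂ) := by
    simpa [div_eq_inv_mul] using hx.const_mul_left (2⁻¹ : ℂ)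
  have hrO : r =O[cobounded ℂ] (fun _ => 1 : ℂ → ℂ) :=
    ((hhalf hκa).sub (hconst _)).sub ((hdefect hida ha0).const_mul_left A0)
  have hsO : s =O[cobounded ℂ] (fun _ => 1 : ℂ → ℂ) :=
    ((hhalf hκc).neg_left.add (hconst _)).add ((hdefect hidc hc0).const_mul_left A2)
  have hequ : ∀ᶠ t in cobounded ℂ,
      t * u t = r t + d t * (2 * t - 2 * v t) + g t * (2 * u t) := by
    filter_upwards [hace, hbdg, hodea, ha0] with t h1 h2 h3 h0
    have he : e t = t - a t - c t := by linear_combination h1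
    have hb : b t = t - d t - g t := by linear_combination h2
    rw [he, hb] at h3
    simp only [hr, hu, hv, hκa_def]
    field_simp
    linear_combination (-2) * h3
  have heqv : ∀ᶠ t in cobounded ℂ,
      t * v t = s t + g t * (2 * t - 2 * u t) + d t * (2 * v t) := by
    filter_upwards [hace, hbdg, hodec, hc0] with t h1 h2 h3 h0
    have he : e t = t - a t - c t := by linear_combination h1
    have hb : b t = t - d t - g t := by linear_combination h2
    rw [he, hb] at h3
    simp only [hs, hu, hv, hκc_def]
    field_simp
    linear_combination 2 * h3
  have hid : (fun t : ℂ => t) =O[cobounded ℂ] fun t => t ^ (Na + Nc + 1) := by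
    simpa [pow_succ] using
      (isBigO_one_id_cobounded.pow (Na + Nc)).mul (isBigO_refl (fun t : ℂ => t) _)
  obtain ⟨huO, hvO⟩ := isBigO_one_of_isBigO_pow hdO hgO hrO hsO hequ heqv (Na + Nc + 1)
    (hid.sub (hNa _ (by omega))) (hid.sub (hNc _ (by omega)))
  have htheta {x : ℂ → ℂ} (hx : (fun t => t) =O[cobounded ℂ] x)
      (hxO : (fun t => t - x t) =O[cobounded ℂ] (fun _ => 1 : ℂ → ℂ)) :
      x =Θ[cobounded ℂ] fun t => t :=
    ⟨by simpa using (isBigO_refl (fun t : ℂ => t) _).sub (hxO.trans isBigO_one_id_cobounded), hx⟩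
  have hsmall {x : ℂ → ℂ} (hx : (fun t => t) =O[cobounded ℂ] x)
      (hxO : (fun t => t - x t) =O[cobounded ℂ] (fun _ => 1 : ℂ → ℂ)) :
      Tendsto (fun t => (t - x t) / x t) (cobounded ℂ) (𝓝 0) := by
    have h1 : (fun _ => 1 : ℂ → ℂ) =o[cobounded ℂ] fun t => t :=
      isLittleO_const_id_cobounded 1
    exact ((hxO.trans_isLittleO h1).trans_isBigO hx).tendsto_div_nhds_zero
  have hrlim : Tendsto r (cobounded ℂ) (𝓝 (A2 + A4)) := by
    have h := (((hκa1 (htheta hida huO)).div_const 2).sub_const (1 / 2 - A2 - A4)).sub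
      ((hsmall hida huO).const_mul A0)
    convert h using 2
    ring
  have hslim : Tendsto s (cobounded ℂ) (𝓝 (-A4 - A0)) := by
    have h := (((hκc1 (htheta hidc hvO)).div_const 2).neg.add_const (1 / 2 - A4 - A0)).add
      ((hsmall hidc hvO).const_mul A2)
    convert h using 2
    ring
  have hlin {x : ℂ → ℂ} (A : ℂ) (hx : x =O[cobounded ℂ] (fun _ => 1 : ℂ → ℂ)) :
      Tendsto (fun t => -A * (t - x t) / t) (cobounded ℂ) (𝓝 (-A)) := by
    have h := ((tendsto_div_id_of_isBigO_one hx).const_sub 1).const_mul (-A)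
    rw [sub_zero, mul_one] at h
    refine h.congr' ?_
    filter_upwards [eventually_ne_cobounded (0 : ℂ)] with t ht
    field_simp
  have hdlim : Tendsto (fun t => t * d t) (cobounded ℂ) (𝓝 A3) := by
    have hF := tendsto_quadratic_div_sq (l := -1) (m := -3) hgO hdO (hvO.const_mul_left 2)
      ((huO.const_mul_left 2).add (hvO.const_mul_left 2))
      ((hconst (1 / 2 - A5 - A1)).sub (hhalf hκd))
    have h := tendsto_id_mul_of_mul_eq (x := d) (by norm_num) hF (hlin A3 hdO) ?_
    · simpa using h
    filter_upwards [hace, hbdg, hoded, hκd'] with t h1 h2 h3 h4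
    have he : e t = t - a t - c t := by linear_combination h1
    have hb : b t = t - d t - g t := by linear_combination h2
    rw [he, hb] at h3
    simp only [hu, hv]
    linear_combination h4 / 2 - h3
  have hglim : Tendsto (fun t => t * g t) (cobounded ℂ) (𝓝 (-A5)) := by
    have hF := tendsto_quadratic_div_sq (l := 1) (m := 3) hdO hgO (huO.const_mul_left (-2))
      ((huO.const_mul_left (-2)).add (hvO.const_mul_left (-2)))
      ((hconst (1 / 2 - A1 - A3)).sub (hhalf hκg))
    have h := tendsto_id_mul_of_mul_eq (x := g) one_ne_zero hF (hlin A5 hgO) ?_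
    · simpa using h
    filter_upwards [hace, hbdg, hodeg, hκg'] with t h1 h2 h3 h4
    have he : e t = t - a t - c t := by linear_combination h1
    have hb : b t = t - d t - g t := by linear_combination h2
    rw [he, hb] at h3
    simp only [hu, hv]
    linear_combination h4 / 2 - h3
  have hulim := tendsto_id_mul_of_eq huO hvO hdlim hglim hrlim hequ
  have hvlim := tendsto_id_mul_of_eq hvO huO hglim hdlim hslim heqv
  refine ⟨?_, ?_, ?_, hdlim, ?_, hglim⟩
  · convert hulim.neg using 2
    · simp only [hu]
      ring
    · ring
  · have h := (hdlim.add hglim).neg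
    rw [show -(A3 + -A5) = -A3 + A5 by ring] at h
    refine h.congr' ?_
    filter_upwards [hbdg] with t ht
    linear_combination -t * ht
  · convert hvlim.neg using 2
    · simp only [hv]
      ring
    · ring
  · have h := hulim.add hvlim
    rw [show A2 + A4 + 2 * A3 + (-A4 - A0 + 2 * -A5) = -A0 + A2 + 2 * A3 - 2 * A5 by ring] at h
    refine h.congr' ?_
    filter_upwards [hace] with t ht
    simp only [hu, hv]
    linear_combination -t * ht
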